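/- There exist constants C>1 and α>0 such that for every n∈ℕ, every 0<ε<1/2, and all a, d ∈ ℕ with d ≥ C·(a + log₂(n/ε)), there exists a function AdvCB : {0,1}^n × {0,1}^d × {0,1}^a → {0,1}^m with output length m ≥ α·d that is a (d, d, ε) strong correlation breaker with advice; in particular the second argument Y is a uniform d-bit seed. (Explicitness/efficient computability is omitted; only existence is asserted.) -/

import Mathlib

/-- `Bits n` is the set of `n`-bit strings `{0,1}^n`. -/
abbrev Bits (n : ℕ) : Type := Fin n → Bool

/-- Statistical distance `Δ(p,q) = max_{T ⊆ S} |p(T) - q(T)|`. -/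
noncomputable def sd {α : Type*} [Fintype α] (p q : PMF α) : ℝ :=
  ⨆ T : Finset α, |∑ x ∈ T, (p x).toReal - ∑ x ∈ T, (q x).toReal|

/-- `X` has min-entropy at least `k`, i.e. `Pr[X = x] ≤ 2^{-k}` for all `x`. -/
def minEntropyGe {α : Type*} (p : PMF α) (k : ℝ) : Prop :=
  ∀ x, (p x).toReal ≤ (2 : ℝ) ^ (-k)

/-- Joint distribution of two independent random variables. -/
noncomputable def prodPMF {α β : Type*} (p : PMF α) (q : PMF β) : PMF (α × β) :=
  p.bind fun x => q.map fun y => (x, y)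

/-- `CB` is a `(k, k', ε)` strong correlation breaker with advice: whenever `(X, X')`
(joint distribution `PX`) with `H∞(X) ≥ k` is independent of `(Y, Y')` (joint
distribution `PY`) with `H∞(Y) ≥ k'`, and `α ≠ α'` are distinct advice strings, then
`Δ((CB(X,Y,α), CB(X',Y',α'), Y, Y'), (U_m, CB(X',Y',α'), Y, Y')) ≤ ε`. -/
def IsStrongAdvCB {n n' a m : ℕ} (k k' ε : ℝ)
    (CB : Bits n → Bits n' → Bits a → Bits m) : Prop :=
  ∀ (PX : PMF (Bits n × Bits n)) (PY : PMF (Bits n' × Bits n')),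
    minEntropyGe (PX.map Prod.fst) k → minEntropyGe (PY.map Prod.fst) k' →
    ∀ αa αb : Bits a, αa ≠ αb →
      sd ((prodPMF PX PY).map fun p => (CB p.1.1 p.2.1 αa, CB p.1.2 p.2.2 αb, p.2))
         (prodPMF (PMF.uniformOfFintype (Bits m))
           ((prodPMF PX PY).map fun p => (CB p.1.2 p.2.2 αb, p.2))) ≤ ε

section Potential

open Finset Real

variable {X Y V A : Type*} [Fintype X] [Fintype Y] [Fintype V] [Fintype A]
  [DecidableEq V]

/-- The indicator of `t` at `(u, v)`, recentred so that its average over `u` vanishes. -/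
noncomputable def centered (t : Finset (V × V)) (u v : V) : ℝ :=
  (if (u, v) ∈ t then 1 else 0) - (∑ u', if (u', v) ∈ t then (1 : ℝ) else 0) / Fintype.card V

/-- The total deviation along the row `r` when the tampered row is read off `r'` via `j`. -/
noncomputable def deviation (j : Y → Y × Finset (V × V)) (r r' : Y → V) : ℝ :=
  ∑ y, centered (j y).2 (r y) (r' (j y).1)

/-- The exponential potential of a single row `r` against all rows of `G'`. -/
noncomputable def rowPotential (w l : ℝ) (j : Y → Y × Finset (V × V)) (r : Y → V)
    (G' : X → Y → V) : ℝ :=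
  1 + ∑ x', w * exp (l * deviation j r (G' x'))

/-- The product over all rows of `G` of the row potentials against `G'`. -/
noncomputable def potential (w l : ℝ) (j : Y → Y × Finset (V × V)) (G G' : X → Y → V) : ℝ :=
  ∏ x, rowPotential w l j (G x) G'

lemma sum_centered [Nonempty V] (t : Finset (V × V)) (v : V) : ∑ u, centered t u v = 0 := by
  have : (Fintype.card V : ℝ) ≠ 0 := by positivity
  simp only [centered, sum_sub_distrib, sum_const, card_univ, nsmul_eq_mul]
  field_simp
  ring

lemma abs_centered_le [Nonempty V] (t : Finset (V × V)) (u v : V) : |centered t u v| ≤ 1 := by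
  have hc : (0 : ℝ) < Fintype.card V := by positivity
  have h0 : 0 ≤ (∑ u', if (u', v) ∈ t then (1 : ℝ) else 0) / Fintype.card V := by positivity
  have h1 : (∑ u', if (u', v) ∈ t then (1 : ℝ) else 0) / Fintype.card V ≤ 1 := by
    rw [div_le_one hc]
    calc (∑ u', if (u', v) ∈ t then (1 : ℝ) else 0) ≤ ∑ _u' : V, (1 : ℝ) :=
          sum_le_sum fun _ _ => by split_ifs <;> norm_num
      _ = Fintype.card V := by simp
  unfold centered
  rw [abs_le]
  split_ifs <;> constructor <;> linarith

lemma sum_exp_centered_le [Nonempty V] {l : ℝ} (hl0 : 0 ≤ l) (hl1 : l ≤ 1)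
    (t : Finset (V × V)) (v : V) :
    ∑ u, exp (l * centered t u v) ≤ Fintype.card V * exp (l ^ 2) := by
  have key : ∀ u, exp (l * centered t u v) ≤ 1 + l ^ 2 + l * centered t u v := by
    intro u
    have hc := abs_centered_le t u v
    have hs : |l * centered t u v| ≤ l := by
      rw [abs_mul, abs_of_nonneg hl0]
      exact mul_le_of_le_one_right hl0 hc
    have h := (abs_le.1 (abs_exp_sub_one_sub_id_le (hs.trans hl1))).2
    have h2 : (l * centered t u v) ^ 2 ≤ l ^ 2 := sq_le_sq.2 (hs.trans (le_abs_self l))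
    linarith
  calc ∑ u, exp (l * centered t u v) ≤ ∑ u, (1 + l ^ 2 + l * centered t u v) :=
        sum_le_sum fun u _ => key u
    _ = Fintype.card V * (1 + l ^ 2) := by
        rw [sum_add_distrib, ← mul_sum, sum_centered]
        simp [mul_add]
    _ ≤ _ := by
        gcongr
        linarith [add_one_le_exp (l ^ 2)]

lemma one_le_rowPotential {w : ℝ} (hw : 0 ≤ w) (l : ℝ) (j : Y → Y × Finset (V × V))
    (r : Y → V) (G' : X → Y → V) : 1 ≤ rowPotential w l j r G' := by
  unfold rowPotential
  have : 0 ≤ ∑ x', w * exp (l * deviation j r (G' x')) := by positivity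
  linarith

lemma sum_exp_deviation_le [DecidableEq Y] [Nonempty V] {l : ℝ} (hl0 : 0 ≤ l) (hl1 : l ≤ 1)
    (j : Y → Y × Finset (V × V)) (r' : Y → V) :
    ∑ r : Y → V, exp (l * deviation j r r')
      ≤ (Fintype.card V * exp (l ^ 2)) ^ Fintype.card Y := by
  have h : ∀ r : Y → V, exp (l * deviation j r r')
      = ∏ y, exp (l * centered (j y).2 (r y) (r' (j y).1)) := fun r => by
    rw [deviation, mul_sum, exp_sum]
  simp only [h]
  rw [← Fintype.piFinset_univ,
    ← prod_univ_sum (fun _ => univ) fun y u => exp (l * centered (j y).2 u (r' (j y).1))]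
  calc _ ≤ ∏ _y : Y, (Fintype.card V * exp (l ^ 2) : ℝ) :=
        prod_le_prod (fun y _ => by positivity) fun y _ => sum_exp_centered_le hl0 hl1 _ _
    _ = _ := by simp

lemma sum_rowPotential_le [DecidableEq Y] [Nonempty V] {w l : ℝ} (hw : 0 ≤ w) (hl0 : 0 ≤ l)
    (hl1 : l ≤ 1) (j : Y → Y × Finset (V × V)) (G' : X → Y → V) :
    ∑ r, rowPotential w l j r G' ≤ (Fintype.card V : ℝ) ^ Fintype.card Y
      * (1 + Fintype.card X * w * exp (l ^ 2) ^ Fintype.card Y) := by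
  simp only [rowPotential, sum_add_distrib]
  rw [sum_comm]
  simp only [← mul_sum]
  have : ∑ x', ∑ r : Y → V, exp (l * deviation j r (G' x'))
      ≤ ∑ _x' : X, ((Fintype.card V : ℝ) * exp (l ^ 2)) ^ Fintype.card Y :=
    sum_le_sum fun x' _ => sum_exp_deviation_le hl0 hl1 j (G' x')
  have h2 := mul_le_mul_of_nonneg_left this hw
  simp only [sum_const, card_univ, nsmul_eq_mul, Fintype.card_pi, prod_const, mul_pow,
    Nat.cast_pow, mul_one] at h2 ⊢
  nlinarith

lemma sum_potential_le [DecidableEq X] [DecidableEq Y] [Nonempty X] [Nonempty V] {w l : ℝ}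
    (hw : 0 ≤ w) (hl0 : 0 ≤ l) (hl1 : l ≤ 1)
    (hwl : Fintype.card X ^ 2 * w * exp (l ^ 2) ^ Fintype.card Y ≤ 1)
    (j : Y → Y × Finset (V × V)) (G' : X → Y → V) :
    ∑ G, potential w l j G G' ≤ Fintype.card (X → Y → V) * exp 1 := by
  have hX : (0 : ℝ) < Fintype.card X := by positivity
  simp only [potential]
  rw [← Fintype.piFinset_univ, ← prod_univ_sum (fun _ => univ) fun _ r => rowPotential w l j r G']
  have hb : 1 + Fintype.card X * w * exp (l ^ 2) ^ Fintype.card Y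
      ≤ exp (1 / Fintype.card X : ℝ) := by
    refine le_trans ?_ (add_one_le_exp _)
    rw [add_comm]
    gcongr
    rw [le_div_iff₀ hX]
    nlinarith
  calc _ ≤ ∏ _x : X, ((Fintype.card V : ℝ) ^ Fintype.card Y * exp (1 / Fintype.card X : ℝ)) :=
        prod_le_prod
          (fun _ _ => sum_nonneg fun r _ => zero_le_one.trans (one_le_rowPotential hw l j r G'))
          fun _ _ => (sum_rowPotential_le hw hl0 hl1 j G').trans (by gcongr)
    _ = _ := by
        simp only [prod_const, card_univ, mul_pow, Fintype.card_pi, Nat.cast_pow]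
        rw [← exp_nat_mul, mul_one_div_cancel hX.ne']

/-- Some family of functions has small potential for all pairs of distinct members at once. -/
lemma exists_potential_le [DecidableEq X] [DecidableEq Y] [DecidableEq A] [Nonempty X]
    [Nonempty V] {w l : ℝ} (hw : 0 ≤ w) (hl0 : 0 ≤ l) (hl1 : l ≤ 1)
    (hwl : Fintype.card X ^ 2 * w * exp (l ^ 2) ^ Fintype.card Y ≤ 1) :
    ∃ F : A → X → Y → V, ∀ a b : A, a ≠ b → ∀ j : Y → Y × Finset (V × V),
      potential w l j (F a) (F b)
        ≤ Fintype.card (A × A × (Y → Y × Finset (V × V))) * exp 1 := by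
  let Φ : (A × A × (Y → Y × Finset (V × V))) → (A → X → Y → V) → ℝ := fun i F =>
    if i.1 = i.2.1 then 0 else potential w l i.2.2 (F i.1) (F i.2.1)
  have hΦ0 : ∀ i F, 0 ≤ Φ i F := by
    intro i F
    simp only [Φ]
    split_ifs
    · exact le_rfl
    · exact prod_nonneg fun x _ => zero_le_one.trans (one_le_rowPotential hw l _ _ _)
  have hΦ : ∀ i, ∑ F, Φ i F ≤ Fintype.card (A → X → Y → V) * exp 1 := by
    rintro ⟨a, b, j⟩
    by_cases hab : a = b
    · simp only [Φ, hab, if_true, sum_const_zero]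
      positivity
    · have hba : b ≠ a := Ne.symm hab
      simp only [Φ, hab, if_false]
      let e := Equiv.funSplitAt a (X → Y → V)
      have h1 : ∑ F : A → X → Y → V, potential w l j (F a) (F b)
          = ∑ z : (X → Y → V) × ({c // c ≠ a} → X → Y → V),
              potential w l j z.1 (z.2 ⟨b, hba⟩) :=
        Fintype.sum_equiv e _ _ fun F => rfl
      rw [h1, Fintype.sum_prod_type_right, Fintype.card_congr e, Fintype.card_prod]
      calc _ ≤ ∑ _z : {c // c ≠ a} → X → Y → V, (Fintype.card (X → Y → V) * exp 1 : ℝ) :=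
            sum_le_sum fun z _ => sum_potential_le hw hl0 hl1 hwl j _
        _ = _ := by
            rw [sum_const, card_univ, nsmul_eq_mul]
            push_cast
            ring
  obtain ⟨F, -, hF⟩ : ∃ F ∈ (univ : Finset (A → X → Y → V)), ∑ i, Φ i F
      ≤ Fintype.card (A × A × (Y → Y × Finset (V × V))) * exp 1 := by
    refine exists_le_of_sum_le univ_nonempty ?_
    rw [sum_comm]
    refine (sum_le_sum fun i _ => hΦ i).trans_eq ?_
    simp only [sum_const, card_univ, nsmul_eq_mul]
    ring
  refine ⟨F, fun a b hab j => ?_⟩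
  have h := (single_le_sum (fun i _ => hΦ0 i F) (mem_univ (a, b, j))).trans hF
  simpa only [Φ, hab, if_false] using h

/-- A small potential bounds the weighted average deviation. -/
lemma sum_mul_deviation_le {w l K Q : ℝ} (hw : 0 < w) (hK : 0 ≤ K)
    {j : Y → Y × Finset (V × V)} {G G' : X → Y → V} (hQ : potential w l j G G' ≤ Q)
    {p : X × X → ℝ} (hp0 : ∀ z, 0 ≤ p z) (hp1 : ∑ z, p z = 1)
    (hp : ∀ x, ∑ x', p (x, x') ≤ K) :
    l * ∑ z, p z * deviation j (G z.1) (G' z.2) + log w ≤ K * log Q := by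
  have hrow : ∀ x, 1 ≤ rowPotential w l j (G x) G' := fun x => one_le_rowPotential hw.le l _ _ _
  have hpt : ∀ z : X × X, l * deviation j (G z.1) (G' z.2) + log w
      ≤ log (rowPotential w l j (G z.1) G') := by
    intro z
    rw [le_log_iff_exp_le (zero_lt_one.trans_le (hrow _)), exp_add, exp_log hw, mul_comm]
    have := single_le_sum (f := fun x' => w * exp (l * deviation j (G z.1) (G' x')))
      (fun _ _ => by positivity) (mem_univ z.2)
    unfold rowPotential
    linarith
  calc l * ∑ z, p z * deviation j (G z.1) (G' z.2) + log w
      = ∑ z, p z * (l * deviation j (G z.1) (G' z.2) + log w) := by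
        simp only [mul_add, sum_add_distrib, ← sum_mul, hp1, one_mul, mul_sum]
        congr 1
        exact sum_congr rfl fun _ _ => by ring
    _ ≤ ∑ z, p z * log (rowPotential w l j (G z.1) G') :=
        sum_le_sum fun z _ => mul_le_mul_of_nonneg_left (hpt z) (hp0 z)
    _ = ∑ x, (∑ x', p (x, x')) * log (rowPotential w l j (G x) G') := by
        rw [Fintype.sum_prod_type]
        simp only [sum_mul]
    _ ≤ ∑ x, K * log (rowPotential w l j (G x) G') :=
        sum_le_sum fun x _ => mul_le_mul_of_nonneg_right (hp x) (log_nonneg (hrow x))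
    _ = K * log (potential w l j G G') := by
        rw [← mul_sum, potential, log_prod fun x _ => (zero_lt_one.trans_le (hrow x)).ne']
    _ ≤ K * log Q := by
        refine mul_le_mul_of_nonneg_left (log_le_log ?_ hQ) hK
        exact prod_pos fun x _ => zero_lt_one.trans_le (hrow x)

/-- Maximising over the tampered seed reduces an arbitrary seed pair to a function of the seed. -/
lemma exists_sum_centered_le [Nonempty Y] {D : ℝ} (G G' : X → Y → V)
    (p : X × X → ℝ) {q : Y × Y → ℝ} (hq0 : ∀ z, 0 ≤ q z) (hq : ∀ y, ∑ y', q (y, y') ≤ D)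
    (T : Y × Y → Finset (V × V)) :
    ∃ j : Y → Y × Finset (V × V),
      ∑ z, p z * ∑ y, q y * centered (T y) (G z.1 y.1) (G' z.2 y.2)
        ≤ D * ∑ z, p z * deviation j (G z.1) (G' z.2) := by
  let g : Y → Y × Finset (V × V) → ℝ := fun y b =>
    ∑ z, p z * centered b.2 (G z.1 y) (G' z.2 b.1)
  have hmax : ∀ y, ∃ b, ∀ b', g y b' ≤ g y b := fun y => Finite.exists_max (g y)
  choose j hj using hmax
  have hj0 : ∀ y, 0 ≤ g y (j y) := fun y =>
    le_of_eq_of_le (by simp [g, centered]) (hj y (y, ∅))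
  refine ⟨j, ?_⟩
  calc ∑ z, p z * ∑ y, q y * centered (T y) (G z.1 y.1) (G' z.2 y.2)
      = ∑ y : Y × Y, q y * g y.1 (y.2, T y) := by
        simp only [g, mul_sum]
        rw [sum_comm]
        exact sum_congr rfl fun _ _ => sum_congr rfl fun _ _ => by ring
    _ ≤ ∑ y : Y × Y, q y * g y.1 (j y.1) :=
        sum_le_sum fun y _ => mul_le_mul_of_nonneg_left (hj _ _) (hq0 y)
    _ = ∑ y, (∑ y', q (y, y')) * g y (j y) := by
        rw [Fintype.sum_prod_type]
        simp only [sum_mul]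
    _ ≤ ∑ y, D * g y (j y) :=
        sum_le_sum fun y _ => mul_le_mul_of_nonneg_right (hq y) (hj0 y)
    _ = _ := by
        simp only [g, deviation, mul_sum]
        rw [sum_comm]

end Potential

section Distributions

open Finset

lemma sum_toReal_eq_one {α : Type*} [Fintype α] (p : PMF α) : ∑ x, (p x).toReal = 1 := by
  rw [← ENNReal.toReal_sum fun x _ => p.apply_ne_top x, ← tsum_fintype (L := .unconditional _),
    p.tsum_coe, ENNReal.toReal_one]

lemma sum_map_toReal_mul {α β : Type*} [Fintype α] [Fintype β] [DecidableEq β] (p : PMF α)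
    (f : α → β) (c : β → ℝ) :
    ∑ y, (p.map f y).toReal * c y = ∑ x, (p x).toReal * c (f x) := by
  have h : ∀ y, (p.map f y).toReal = ∑ x, if y = f x then (p x).toReal else 0 := by
    intro y
    rw [PMF.map_apply, tsum_fintype, ENNReal.toReal_sum]
    · refine sum_congr rfl fun x _ => ?_
      split_ifs <;> simp
    · intro x _
      split_ifs
      · exact p.apply_ne_top x
      · exact ENNReal.zero_ne_top
  simp only [h, sum_mul]
  rw [sum_comm]
  refine sum_congr rfl fun x _ => ?_
  simp [ite_mul]

lemma prodPMF_apply_toReal {α β : Type*} [Fintype α] [Fintype β] (p : PMF α) (q : PMF β)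
    (z : α × β) : (prodPMF p q z).toReal = (p z.1).toReal * (q z.2).toReal := by
  classical
  rw [← ENNReal.toReal_mul]
  congr 1
  obtain ⟨a, b⟩ := z
  simp only [prodPMF, PMF.bind_apply, PMF.map_apply, tsum_fintype, Prod.mk.injEq]
  rw [sum_eq_single a (fun x _ hx => by simp [Ne.symm hx]) (by simp)]
  simp

lemma sd_le_of_forall_sub_le {α : Type*} [Fintype α] {p q : PMF α} {ε : ℝ}
    (h : ∀ T : Finset α, ∑ x ∈ T, (p x).toReal - ∑ x ∈ T, (q x).toReal ≤ ε) : sd p q ≤ ε := by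
  classical
  refine ciSup_le fun T => abs_le.2 ⟨?_, h T⟩
  have hp := sum_add_sum_compl T fun x => (p x).toReal
  have hq := sum_add_sum_compl T fun x => (q x).toReal
  rw [sum_toReal_eq_one] at hp hq
  linarith [h Tᶜ]

lemma sum_fiber_toReal_le {α β : Type*} [Fintype α] [Fintype β] [DecidableEq α]
    {p : PMF (α × β)} {k : ℝ} (h : minEntropyGe (p.map Prod.fst) k) (x : α) :
    ∑ y, (p (x, y)).toReal ≤ (2 : ℝ) ^ (-k) := by
  refine le_of_eq_of_le ?_ (h x)
  have := sum_map_toReal_mul p Prod.fst fun x' => if x' = x then 1 else 0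
  rw [Fintype.sum_prod_type] at this
  simpa using this.symm

lemma one_le_card_mul_of_minEntropyGe {α : Type*} [Fintype α] {p : PMF α} {k : ℝ}
    (h : minEntropyGe p k) : 1 ≤ Fintype.card α * (2 : ℝ) ^ (-k) := by
  rw [← sum_toReal_eq_one p, ← nsmul_eq_mul]
  exact sum_le_card_nsmul _ _ _ fun x _ => h x

/-- The slice of a set of triples over its last coordinate. -/
def lastSlice {U V Z : Type*} [DecidableEq U] [DecidableEq V] [DecidableEq Z]
    (T : Finset (U × V × Z)) (z : Z) : Finset (U × V) :=
  (T.filter fun t => t.2.2 = z).image fun t => (t.1, t.2.1)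

lemma mem_lastSlice {U V Z : Type*} [DecidableEq U] [DecidableEq V] [DecidableEq Z]
    {T : Finset (U × V × Z)} {z : Z} {u : U} {v : V} : (u, v) ∈ lastSlice T z ↔ (u, v, z) ∈ T := by
  simp [lastSlice]

variable {n n' a m : ℕ}

lemma sum_sub_sum_eq_sum_centered (CB : Bits n → Bits n' → Bits a → Bits m)
    (PX : PMF (Bits n × Bits n)) (PY : PMF (Bits n' × Bits n')) (s s' : Bits a)
    (T : Finset (Bits m × Bits m × Bits n' × Bits n')) :
    ∑ z ∈ T, ((prodPMF PX PY).map (fun p => (CB p.1.1 p.2.1 s, CB p.1.2 p.2.2 s', p.2)) z).toReal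
      - ∑ z ∈ T, (prodPMF (PMF.uniformOfFintype (Bits m))
          ((prodPMF PX PY).map fun p => (CB p.1.2 p.2.2 s', p.2)) z).toReal
      = ∑ x, (PX x).toReal * ∑ y : Bits n' × Bits n', (PY y).toReal *
          centered (lastSlice T y) (CB x.1 y.1 s) (CB x.2 y.2 s') := by
  have hT : ∀ P : PMF (Bits m × Bits m × Bits n' × Bits n'), ∑ z ∈ T, (P z).toReal
      = ∑ z, (P z).toReal * if z ∈ T then 1 else 0 := fun P => by simp
  rw [hT, hT, sum_map_toReal_mul, Fintype.sum_prod_type (f := fun z =>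
    (prodPMF (PMF.uniformOfFintype (Bits m)) _ z).toReal * _)]
  simp only [prodPMF_apply_toReal, PMF.uniformOfFintype_apply, mul_assoc, ← mul_sum]
  simp only [sum_map_toReal_mul _ _ fun z => if (_, z) ∈ T then (1 : ℝ) else 0]
  simp only [prodPMF_apply_toReal]
  rw [sum_comm, mul_sum, ← sum_sub_distrib, Fintype.sum_prod_type]
  refine sum_congr rfl fun x _ => ?_
  rw [mul_sum]
  refine sum_congr rfl fun y _ => ?_
  simp only [centered, mem_lastSlice, ← mul_sum, ENNReal.toReal_inv,
    ENNReal.toReal_natCast]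
  ring

lemma isStrongAdvCB_of_lt {k k' ε : ℝ} (hk : n < k) (CB : Bits n → Bits n' → Bits a → Bits m) :
    IsStrongAdvCB k k' ε CB := by
  intro PX PY hX
  have h := one_le_card_mul_of_minEntropyGe hX
  have hlt : (2 : ℝ) ^ (n : ℝ) * 2 ^ (-k) < 1 := by
    rw [← Real.rpow_add two_pos]
    exact Real.rpow_lt_one_of_one_lt_of_neg one_lt_two (by linarith)
  simp only [Fintype.card_pi, Fintype.card_bool, prod_const, card_univ, Fintype.card_fin,
    Nat.cast_pow, Nat.cast_ofNat] at h
  rw [Real.rpow_natCast] at hlt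
  linarith

open Real in
lemma exists_isStrongAdvCB {n a d m : ℕ} {ε : ℝ} (hε0 : 0 < ε) (hε1 : ε < 1 / 2)
    (h : 4 * (2 * n + 1 + 2 * a + d + (2 ^ m) ^ 2) ≤ ε ^ 2 * (2 : ℝ) ^ d) :
    ∃ CB : Bits n → Bits d → Bits a → Bits m, IsStrongAdvCB (d : ℝ) (d : ℝ) ε CB := by
  set w : ℝ := ((2 ^ n) ^ 2 * exp ((ε / 2) ^ 2 * 2 ^ d))⁻¹ with hw
  have hw0 : 0 < w := by positivity
  have hwl : Fintype.card (Bits n) ^ 2 * w * exp ((ε / 2) ^ 2) ^ Fintype.card (Bits d) ≤ 1 := by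
    refine le_of_eq ?_
    rw [← exp_nat_mul, hw]
    simp only [Fintype.card_pi, Fintype.card_bool, prod_const, card_univ, Fintype.card_fin,
      Nat.cast_pow, Nat.cast_ofNat]
    rw [mul_comm ((2 : ℝ) ^ d)]
    field_simp
  obtain ⟨F, hF⟩ := exists_potential_le (A := Bits a) (Y := Bits d) (V := Bits m) hw0.le
    (by linarith : 0 ≤ ε / 2) (by linarith) hwl
  refine ⟨fun x y s => F s x y, fun PX PY hX hY s s' hs => sd_le_of_forall_sub_le fun T => ?_⟩
  rw [sum_sub_sum_eq_sum_centered fun x y s => F s x y]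
  have hD : (0 : ℝ) ≤ 2 ^ (-(d : ℝ)) := by positivity
  obtain ⟨j, hj⟩ := exists_sum_centered_le (F s) (F s') (fun z => (PX z).toReal)
    (fun z => ENNReal.toReal_nonneg) (sum_fiber_toReal_le hY)
    (lastSlice T)
  refine hj.trans ?_
  have hdev := sum_mul_deviation_le hw0 hD (hF s s' hs j)
    (fun z => ENNReal.toReal_nonneg) (sum_toReal_eq_one PX) (sum_fiber_toReal_le hX)
  set S := ∑ z, (PX z).toReal * deviation j (F s z.1) (F s' z.2)
  have hlogw : log w = -(2 * n * log 2 + (ε / 2) ^ 2 * 2 ^ d) := by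
    rw [hw, log_inv, log_mul (by positivity) (by positivity), log_exp, log_pow, log_pow]
    push_cast
    ring
  have hlogQ : log (Fintype.card (Bits a × Bits a × (Bits d → Bits d × Finset (Bits m × Bits m)))
      * exp 1) = 2 * a * log 2 + 2 ^ d * ((d + (2 ^ m) ^ 2) * log 2) + 1 := by
    have hcard : (Fintype.card (Bits a × Bits a × (Bits d → Bits d × Finset (Bits m × Bits m))) : ℝ)
        = 2 ^ a * (2 ^ a * (2 ^ d * 2 ^ (2 ^ m * 2 ^ m)) ^ (2 ^ d)) := by
      simp
    rw [hcard, log_mul (by positivity) (by positivity), log_exp,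
      log_mul (by positivity) (by positivity), log_mul (by positivity) (by positivity),
      log_pow, log_pow, log_mul (by positivity) (by positivity), log_pow, log_pow]
    push_cast
    ring
  rw [hlogw, hlogQ] at hdev
  rw [rpow_neg two_pos.le, rpow_natCast] at hdev ⊢
  set D : ℝ := 2 ^ d with hDdef
  have hD1 : 1 ≤ D := one_le_pow₀ one_le_two
  have hlog0 : 0 ≤ log 2 := log_nonneg one_le_two
  have hlog1 : log 2 ≤ 1 := by linarith [log_two_lt_d9]
  have hb : D⁻¹ * (2 * a * log 2 + D * ((d + (2 ^ m) ^ 2) * log 2) + 1)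
      ≤ 2 * a + (d + (2 ^ m) ^ 2) + 1 := by
    have h1 : D⁻¹ * (2 * a * log 2 + D * ((d + (2 ^ m) ^ 2) * log 2) + 1)
        = D⁻¹ * (2 * a * log 2 + 1) + (d + (2 ^ m) ^ 2) * log 2 := by
      field_simp
      ring
    have h2 : D⁻¹ * (2 * a * log 2 + 1) ≤ 1 * (2 * a * 1 + 1) := by
      gcongr
      exact inv_le_one_of_one_le₀ hD1
    have h3 : (d + (2 ^ m) ^ 2 : ℝ) * log 2 ≤ (d + (2 ^ m) ^ 2) * 1 := by gcongr
    linarith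
  have hn : 2 * n * log 2 ≤ 2 * (n : ℝ) * 1 := by gcongr
  have hfin : ε / 2 * S ≤ ε / 2 * (ε * D) := by nlinarith
  have hS : S ≤ ε * D := le_of_mul_le_mul_left hfin (by linarith)
  rw [inv_mul_le_iff₀ (by linarith)]
  linarith

end Distributions

lemma mul_add_le_of_pow_le {r s D : ℝ} (hr : 2 ≤ r) (hs : 1 ≤ s) (hrD : r ^ 20 ≤ D)
    (hsD : s ^ 4 ≤ D) : 28 * r ^ 3 + 4 * s * r ^ 2 ≤ D := by
  have p2 : (4 : ℝ) ≤ r ^ 2 := by nlinarith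
  have p4 : (16 : ℝ) ≤ r ^ 4 := by nlinarith
  have h20 : 4096 * r ^ 8 ≤ r ^ 20 := by
    have : (2 : ℝ) ^ 12 ≤ r ^ 12 := by gcongr
    calc 4096 * r ^ 8 ≤ r ^ 12 * r ^ 8 := by
          gcongr
          linarith
      _ = r ^ 20 := by ring
  have h3 : 28 * r ^ 3 ≤ r ^ 8 := by
    have : (2 : ℝ) ^ 5 ≤ r ^ 5 := by gcongr
    calc 28 * r ^ 3 ≤ r ^ 5 * r ^ 3 := by
          gcongr
          linarith
      _ = r ^ 8 := by ring
  have h4 : 4 * s * r ^ 2 ≤ s * r ^ 4 := by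
    have : 4 * r ^ 2 ≤ r ^ 4 := by nlinarith
    nlinarith
  have h8 : 0 ≤ r ^ 8 := by positivity
  rcases le_total s (r ^ 4) with h | h
  · have : s * r ^ 4 ≤ r ^ 4 * r ^ 4 := by gcongr
    nlinarith
  · have h5 : s * r ^ 4 ≤ s * s := by gcongr
    have h6 : 256 * s ^ 2 ≤ s ^ 4 := by
      have : 16 * 16 ≤ s * s := by nlinarith
      nlinarith [sq_nonneg s]
    nlinarith

/-- There exist constants `C > 1` and `α > 0` such that for every `n`, every
`0 < ε < 1/2` and all `a, d` with `d ≥ C(a + log₂(n/ε))` there is a `(d, d, ε)` strong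
correlation breaker with advice `AdvCB : {0,1}^n × {0,1}^d × {0,1}^a → {0,1}^m` with
`m ≥ α d`; in particular the second argument is a uniform `d`-bit seed (a `d`-bit
random variable of min-entropy `≥ d` is uniform). -/
theorem stmt_18 :
    ∃ C : ℝ, C > 1 ∧
      ∃ α : ℝ, α > 0 ∧
        ∀ n : ℕ, ∀ ε : ℝ, 0 < ε → ε < 1 / 2 →
          ∀ a d : ℕ, (d : ℝ) ≥ C * (a + Real.logb 2 (n / ε)) →
            ∃ m : ℕ, (m : ℝ) ≥ α * d ∧
              ∃ AdvCB : Bits n → Bits d → Bits a → Bits m,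
                IsStrongAdvCB (d : ℝ) (d : ℝ) ε AdvCB := by
  refine ⟨20, by norm_num, 1 / 16, by norm_num, fun n ε hε0 hε1 a d hd => ?_⟩
  rcases lt_or_ge n d with hnd | hnd
  · exact ⟨d, by linarith [(Nat.cast_nonneg d : (0 : ℝ) ≤ d)], fun _ y _ => y,
      isStrongAdvCB_of_lt (by exact_mod_cast hnd) _⟩
  rcases Nat.eq_zero_or_pos n with rfl | hn
  · obtain rfl : d = 0 := by omega
    obtain rfl : a = 0 := by
      simp only [CharP.cast_eq_zero, zero_div, Real.logb_zero, add_zero, ge_iff_le] at hd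
      have : (a : ℝ) ≤ 0 := by linarith
      exact_mod_cast le_antisymm this (Nat.cast_nonneg a)
    exact ⟨0, by simp, fun _ _ _ => Fin.elim0, fun _ _ _ _ s s' hs =>
      (hs (Subsingleton.elim s s')).elim⟩
  have hn1 : (1 : ℝ) ≤ n := by exact_mod_cast hn
  set r : ℝ := n / ε with hr
  have hr2 : 2 ≤ r := by
    rw [hr, le_div_iff₀ hε0]
    linarith
  have hlog : 1 ≤ Real.logb 2 r := by
    rw [Real.le_logb_iff_rpow_le one_lt_two (by linarith)]
    simpa using hr2
  have ha0 : (0 : ℝ) ≤ a := Nat.cast_nonneg a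
  have had : (a : ℝ) ≤ d := by linarith
  have hd20 : 20 ≤ d := by
    have : (20 : ℝ) ≤ d := by linarith
    exact_mod_cast this
  have hrD : r ^ 20 ≤ (2 : ℝ) ^ d := by
    have h : Real.logb 2 (r ^ 20) ≤ d := by
      rw [Real.logb_pow]
      push_cast
      linarith
    rwa [Real.logb_le_iff_le_rpow one_lt_two (by positivity), Real.rpow_natCast] at h
  have hsD : (((2 : ℝ) ^ (d / 8)) ^ 2) ^ 4 ≤ 2 ^ d := by
    rw [← pow_mul, ← pow_mul]
    exact pow_le_pow_right₀ one_le_two (by omega)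
  have hmain := mul_add_le_of_pow_le hr2
    (one_le_pow₀ (one_le_pow₀ one_le_two) : 1 ≤ ((2 : ℝ) ^ (d / 8)) ^ 2) hrD hsD
  refine ⟨d / 8, ?_, exists_isStrongAdvCB hε0 hε1 ?_⟩
  · have : d ≤ 16 * (d / 8) := by omega
    have : (d : ℝ) ≤ 16 * (d / 8 : ℕ) := by exact_mod_cast this
    linarith
  · have hnε : r * ε = n := div_mul_cancel₀ _ hε0.ne'
    have hdn : (d : ℝ) ≤ n := by exact_mod_cast hnd
    set s : ℝ := ((2 : ℝ) ^ (d / 8)) ^ 2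
    have hs : 0 ≤ s := by positivity
    have h1 : 4 * (2 * n + 1 + 2 * a + d + s) ≤ 28 * (n : ℝ) + 4 * s := by linarith
    have h2 : 28 * (n : ℝ) + 4 * s ≤ ε ^ 2 * (28 * r ^ 3 + 4 * s * r ^ 2) := by
      have h3 : ε ^ 2 * (28 * r ^ 3 + 4 * s * r ^ 2) = (28 * r + 4 * s) * (n : ℝ) ^ 2 := by
        rw [← hnε]
        ring
      have h4 : (n : ℝ) ≤ r := by
        rw [hr, le_div_iff₀ hε0]
        nlinarith
      have h5 : (1 : ℝ) ≤ (n : ℝ) ^ 2 := one_le_pow₀ hn1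
      rw [h3]
      nlinarith
    exact h1.trans (h2.trans (by gcongr))
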